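/- arXiv:2406.18299 — 3 statements merged into one kernel-verified Lean document; each statement's English description precedes it below -/
import Mathlib

section
/- For every v ∈ V: if there is a stable witness walk starting at v, then there is a stable witness walk starting at v of length at most 10. -/
/-- The core conditions of a *witness walk* starting at `v`:
a sequence `w 0, w 1, …, w (j-1)` of `j ≥ 1` elements of `V`, starting at `v`,
whose elements other than the last one are pairwise distinct,
and such that consecutive elements are related by `W`. Its length is `j`. -/
def IsWitnessWalkCore {V : Type*} (W : V → V → Prop) (v : V) (j : ℕ) (w : ℕ → V) : Prop :=
  1 ≤ j ∧ w 0 = v ∧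
    (∀ i₁ i₂, i₁ + 1 < j → i₂ + 1 < j → i₁ ≠ i₂ → w i₁ ≠ w i₂) ∧
    (∀ i, i + 1 < j → W (w i) (w (i + 1)))

/-- A *stable witness walk* starting at `v`: a witness walk that is returning
(its last element repeats an earlier element). -/
def IsStableWitnessWalk {V : Type*} (W : V → V → Prop) (v : V) (j : ℕ) (w : ℕ → V) : Prop :=
  IsWitnessWalkCore W v j w ∧ ∃ i, i + 1 < j ∧ w (j - 1) = w i

theorem key_aux {V : Type*} (A : V → V → Prop) (hA : Symmetric A)
    (W : V → V → Prop) (f : Prop → Prop → Prop → Prop → Prop)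
    (hW : ∀ x y : V, W x y ↔ f (x = y) (A x y) (A x x) (A y y)) (x0 x1 x2 x3 : V)
    (h01 : W x0 x1) (h12 : W x1 x2) (h23 : W x2 x3)
    (n10 : ¬ W x1 x0) (n21 : ¬ W x2 x1) (n32 : ¬ W x3 x2) :
    W x0 x3 ∨ W x3 x0 := by
  have hsym : ∀ x y, A x y = A y x := fun x y => propext ⟨fun h => hA h, fun h => hA h⟩
  have step : ∀ x y, W x y → ¬ W y x → (x = y) = False ∧ (A y y = ¬ A x x) := by
    intro x y h n
    have hne : x ≠ y := by rintro rfl; exact n h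
    refine ⟨eq_false hne, ?_⟩
    by_contra hc
    have he : A x x = A y y := by
      by_cases p : A x x <;> by_cases q : A y y <;> simp_all
    apply n
    rw [hW] at h ⊢
    rw [eq_false hne.symm, hsym y x, ← he]
    rw [eq_false hne, ← he] at h
    exact h
  obtain ⟨e01, t1⟩ := step _ _ h01 n10
  obtain ⟨e12, t2⟩ := step _ _ h12 n21
  obtain ⟨e23, t3⟩ := step _ _ h23 n32
  have e10 : (x1 = x0) = False := by rw [← e01]; exact propext eq_comm
  have e21 : (x2 = x1) = False := by rw [← e12]; exact propext eq_comm
  have t2' : A x2 x2 = A x0 x0 := by rw [t2, t1]; simp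
  have t3' : A x3 x3 = ¬ A x0 x0 := by rw [t3, t2']
  have e03 : (x0 = x3) = False := by
    apply eq_false
    intro h
    rw [← h] at t3'
    by_cases p : A x0 x0
    · exact (t3' ▸ p : ¬ A x0 x0) p
    · exact p (t3'.symm ▸ p)
  have e30 : (x3 = x0) = False := by rw [← e03]; exact propext eq_comm
  rw [hW, e01, t1] at h01
  rw [hW, e10, t1, hsym x1 x0] at n10
  rw [hW, e12, t1, t2'] at h12
  rw [hW, e21, t1, t2', hsym x2 x1] at n21
  rw [hW, hW, e03, e30, t3', hsym x3 x0]
  have hd : A x0 x1 ≠ A x1 x2 := by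
    intro h; rw [h] at h01; exact n21 h01
  by_cases h : A x0 x3 = A x0 x1
  · left; rw [h]; exact h01
  · right
    have : A x0 x3 = A x1 x2 := by
      by_cases p : A x0 x3 <;> by_cases q : A x0 x1 <;> by_cases r : A x1 x2 <;> simp_all
    rw [this]; exact h12

def RepWalk {V : Type*} (W : V → V → Prop) (v : V) (b : ℕ) : Prop :=
  ∃ (w : ℕ → V) (a : ℕ), a < b ∧ w 0 = v ∧ w a = w b ∧ ∀ i, i < b → W (w i) (w (i + 1))

theorem RepWalk.close {V : Type*} {W : V → V → Prop} (w : ℕ → V) (k i : ℕ) (hi : i ≤ k)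
    (hs : ∀ n, n < k → W (w n) (w (n + 1))) (hb : W (w k) (w i)) : RepWalk W (w 0) (k + 1) := by
  refine ⟨fun n => if n ≤ k then w n else w i, i, by omega, by simp, by simp [hi], ?_⟩
  intro n hn
  rcases Nat.lt_or_ge n k with h | h
  · have h1 : n ≤ k := by omega
    have h2 : n + 1 ≤ k := by omega
    simp only [h1, h2, if_true]
    exact hs n h
  · obtain rfl : n = k := by omega
    simpa using hb

theorem RepWalk.shortcut {V : Type*} {W : V → V → Prop} (w : ℕ → V) (a b i : ℕ) (hab : a < b)
    (heq : w a = w b) (hs : ∀ n, n < b → W (w n) (w (n + 1))) (hib : i + 3 ≤ b)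
    (hc : W (w i) (w (i + 3))) (hai : a ≤ i ∨ i + 3 ≤ a) : RepWalk W (w 0) (b - 2) := by
  refine ⟨fun n => if n ≤ i then w n else w (n + 2), if a ≤ i then a else a - 2, ?_, by simp, ?_, ?_⟩
  · split <;> omega
  · have h1 : ¬ (b - 2 ≤ i) := by omega
    have h2 : b - 2 + 2 = b := by omega
    simp only [h1, if_false, h2]
    rcases hai with h | h
    · simp [h, heq]
    · have h3 : ¬ a ≤ i := by omega
      have h4 : ¬ (a - 2 ≤ i) := by omega
      have h5 : a - 2 + 2 = a := by omega
      simp only [h3, h4, h5, if_false, heq]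
  · intro n hn
    rcases Nat.lt_trichotomy n i with h | h | h
    · have h1 : n ≤ i := by omega
      have h2 : n + 1 ≤ i := by omega
      simp only [h1, h2, if_true]
      exact hs n (by omega)
    · subst h
      simpa using hc
    · have h1 : ¬ n ≤ i := by omega
      have h2 : ¬ n + 1 ≤ i := by omega
      simp only [h1, h2, if_false]
      exact hs (n + 2) (by omega)

/-- if `V` is the vertex set of a finite undirected graph with
self-loops allowed, given by a symmetric relation `A`, and `W` is determined by `A`
(via a truth function `f` of the four indicated atoms), then whenever a stable
witness walk starts at `v`, there is also one of length at most `10`. -/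
theorem stmt_3 {V : Type*} [Fintype V] (A : V → V → Prop) (hA : Symmetric A)
    (W : V → V → Prop) (f : Prop → Prop → Prop → Prop → Prop)
    (hW : ∀ x y : V, W x y ↔ f (x = y) (A x y) (A x x) (A y y)) :
    ∀ v : V,
      (∃ (j : ℕ) (w : ℕ → V), IsStableWitnessWalk W v j w) →
      ∃ (j : ℕ) (w : ℕ → V), j ≤ 10 ∧ IsStableWitnessWalk W v j w := by
  classical
  rintro v ⟨j, w, ⟨hj, h0, hd, hs⟩, a, ha, hr⟩
  have hex : ∃ b, RepWalk W v b :=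
    ⟨j - 1, w, a, by omega, h0, hr.symm, fun i hi => hs i (by omega)⟩
  clear hd hs hr ha h0 hj a w j
  obtain ⟨b, hb, hmin⟩ : ∃ b, RepWalk W v b ∧ ∀ m, m < b → ¬ RepWalk W v m :=
    ⟨Nat.find hex, Nat.find_spec hex, fun m hm => Nat.find_min hex hm⟩
  obtain ⟨w, a, hab, rfl, heq, hs⟩ := hb
  have hdist : ∀ i k, i < k → k < b → w i ≠ w k := fun i k hik hk he =>
    hmin k hk ⟨w, i, hik, rfl, he, fun n hn => hs n (by omega)⟩
  have hback : ∀ i k, i ≤ k → k + 1 < b → ¬ W (w k) (w i) := fun i k hik hk he =>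
    hmin (k + 1) hk (RepWalk.close w k i hik (fun n hn => hs n (by omega)) he)
  refine ⟨b + 1, w, ?_, ⟨by omega, rfl, ?_, fun i hi => hs i (by omega)⟩, a, by omega, heq.symm⟩
  · by_contra hbig
    obtain ⟨i, hi, hai⟩ : ∃ i, i ≤ 2 ∧ (a ≤ i ∨ i + 3 ≤ a) := by
      by_cases h : a ≤ 2
      · exact ⟨a, h, Or.inl le_rfl⟩
      · exact ⟨0, by omega, Or.inr (by omega)⟩
    rcases key_aux A hA W f hW (w i) (w (i + 1)) (w (i + 2)) (w (i + 3))
      (hs _ (by omega)) (hs _ (by omega)) (hs _ (by omega))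
      (hback _ _ (by omega) (by omega)) (hback _ _ (by omega) (by omega))
      (hback _ _ (by omega) (by omega)) with h | h
    · exact hmin (b - 2) (by omega) (RepWalk.shortcut w a b i hab heq hs (by omega) h hai)
    · exact hback i (i + 3) (by omega) (by omega) h
  · intro i k hi hk hne
    rcases Nat.lt_or_gt_of_ne hne with h | h
    · exact hdist i k h (by omega)
    · exact (hdist k i h (by omega)).symm
end

section
/- If t is reachable from s by a directed path in G, then there is a set D of at most k vertices of G′ such that the induced subgraph G′ ∖ D satisfies property Q. -/
/-- A directed graph on `Fin n × Fin k` (layer `i+1`, 1-based, is `Fin n × {i}`) is a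
*matched layered graph* if every edge goes from a layer to the next one, every vertex
outside the last layer has exactly one out-neighbor, and every vertex outside the
first layer has exactly one in-neighbor. -/
def MatchedLayered {n k : ℕ} (E : Fin n × Fin k → Fin n × Fin k → Prop) : Prop :=
  (∀ v w, E v w → (w.2 : ℕ) = (v.2 : ℕ) + 1) ∧
    (∀ v, (v.2 : ℕ) + 1 < k → ∃! w, E v w) ∧
    (∀ w, 0 < (w.2 : ℕ) → ∃! v, E v w)

/-- The vertex set of the graph `G′`: the original vertices; the vertices `v⁺` for path
ends `v = (a, t.2) ≠ t`; the `k+1` vertices `u₁ˢ, …, u_{k+1}ˢ`; for each original edge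
`(v, w)` (with `E v w`) `k+1` triangle vertices; and for each edge `{v, v⁺}` another
`k+1` triangle vertices. -/
def Vert (n k : ℕ) (E : Fin n × Fin k → Fin n × Fin k → Prop) (t : Fin n × Fin k) : Type :=
  (Fin n × Fin k) ⊕
    ({a : Fin n // a ≠ t.1} ⊕
      (Fin (k + 1) ⊕
        (({p : (Fin n × Fin k) × (Fin n × Fin k) // E p.1 p.2} × Fin (k + 1)) ⊕
          ({a : Fin n // a ≠ t.1} × Fin (k + 1)))))

/-- The edges of `G′`: the underlying undirected edges of `G`; the edge `{v, v⁺}` for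
each path end `v ≠ t`; the `k+1` edges `{s, uᵢˢ}`; and, for every edge `e = {u, v}` of
the graph built so far other than the edges incident to the `uᵢˢ`, the edges
`{u, uᵢᵉ}` and `{v, uᵢᵉ}` for the `k+1` new vertices `uᵢᵉ` associated with `e`. -/
inductive GRel {n k : ℕ} (E : Fin n × Fin k → Fin n × Fin k → Prop) (s t : Fin n × Fin k) :
    Vert n k E t → Vert n k E t → Prop
  | base {v w} : E v w → GRel E s t (Sum.inl v) (Sum.inl w)
  | plus (a : {a : Fin n // a ≠ t.1}) :
      GRel E s t (Sum.inl (a.1, t.2)) (Sum.inr (Sum.inl a))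
  | pendant (j : Fin (k + 1)) : GRel E s t (Sum.inl s) (Sum.inr (Sum.inr (Sum.inl j)))
  | triBaseFst (p : {p : (Fin n × Fin k) × (Fin n × Fin k) // E p.1 p.2}) (j : Fin (k + 1)) :
      GRel E s t (Sum.inl p.1.1) (Sum.inr (Sum.inr (Sum.inr (Sum.inl (p, j)))))
  | triBaseSnd (p : {p : (Fin n × Fin k) × (Fin n × Fin k) // E p.1 p.2}) (j : Fin (k + 1)) :
      GRel E s t (Sum.inl p.1.2) (Sum.inr (Sum.inr (Sum.inr (Sum.inl (p, j)))))
  | triPlusFst (a : {a : Fin n // a ≠ t.1}) (j : Fin (k + 1)) :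
      GRel E s t (Sum.inl (a.1, t.2)) (Sum.inr (Sum.inr (Sum.inr (Sum.inr (a, j)))))
  | triPlusSnd (a : {a : Fin n // a ≠ t.1}) (j : Fin (k + 1)) :
      GRel E s t (Sum.inr (Sum.inl a)) (Sum.inr (Sum.inr (Sum.inr (Sum.inr (a, j)))))

/-- Property `Q` of an undirected simple graph `H`: every edge lies in a triangle. -/
def PropQ {X : Type*} (H : SimpleGraph X) : Prop :=
  ∀ x y : X, H.Adj x y → ∃ z : X, H.Adj x z ∧ H.Adj y z


theorem aux_inj {n k : ℕ} {E : Fin n × Fin k → Fin n × Fin k → Prop}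
    (hE : MatchedLayered E) {s : Fin n × Fin k} (hs : (s.2 : ℕ) = 0) {v : Fin n × Fin k}
    (hv : Relation.ReflTransGen E s v) :
    ∀ w, Relation.ReflTransGen E s w → v.2 = w.2 → v = w := by
  induction hv with
  | refl =>
    intro w hw h
    rcases Relation.ReflTransGen.cases_tail hw with h1 | ⟨c, _, h2⟩
    · exact h1.symm
    · have := hE.1 _ _ h2
      rw [← h] at this
      omega
  | tail hb hbc ih =>
    rename_i b c
    intro w hw h
    have h1 := hE.1 _ _ hbc
    rcases Relation.ReflTransGen.cases_tail hw with h2 | ⟨d, hd, h2⟩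
    · subst h2
      rw [h] at h1
      omega
    · have h3 := hE.1 _ _ h2
      have hbd : b = d := ih d hd (by
        apply Fin.ext
        rw [h] at h1
        omega)
      subst hbd
      have hlt : (b.2 : ℕ) + 1 < k := by
        have := c.2.isLt
        omega
      exact (hE.2.1 b hlt).unique hbc h2

theorem aux_back {n k : ℕ} {E : Fin n × Fin k → Fin n × Fin k → Prop}
    (hE : MatchedLayered E) {s : Fin n × Fin k} (hs : (s.2 : ℕ) = 0) {v w : Fin n × Fin k}
    (hw : Relation.ReflTransGen E s w) (h : E v w) : Relation.ReflTransGen E s v := by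
  have h1 := hE.1 _ _ h
  rcases Relation.ReflTransGen.cases_tail hw with h2 | ⟨d, hd, h2⟩
  · subst h2
    omega
  · have : v = d := (hE.2.2 w (by omega)).unique h h2
    exact this ▸ hd

theorem aux_irrefl {n k : ℕ} {E : Fin n × Fin k → Fin n × Fin k → Prop}
    (hE : MatchedLayered E) {s t : Fin n × Fin k} {x y : Vert n k E t}
    (h : GRel E s t x y) : x ≠ y := by
  cases h with
  | base h =>
    intro e
    have e' := Sum.inl.inj e
    have := hE.1 _ _ h
    rw [e'] at this
    omega
  | plus a => exact fun e => nomatch e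
  | pendant j => exact fun e => nomatch e
  | triBaseFst p j => exact fun e => nomatch e
  | triBaseSnd p j => exact fun e => nomatch e
  | triPlusFst a j => exact fun e => nomatch e
  | triPlusSnd a j => exact fun e => nomatch e

def auxD {n k : ℕ} (E : Fin n × Fin k → Fin n × Fin k → Prop) (s t : Fin n × Fin k) :
    Set (Vert n k E t) := Sum.inl '' {v | Relation.ReflTransGen E s v}

theorem aux_inl {n k : ℕ} {E : Fin n × Fin k → Fin n × Fin k → Prop} {s t v : Fin n × Fin k} :
    (Sum.inl v : Vert n k E t) ∈ auxD E s t ↔ Relation.ReflTransGen E s v := by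
  constructor
  · rintro ⟨w, hw, e⟩
    exact (Sum.inl.inj e) ▸ hw
  · intro h
    exact ⟨v, h, rfl⟩

theorem aux_inr {n k : ℕ} {E : Fin n × Fin k → Fin n × Fin k → Prop} {s t : Fin n × Fin k} {v} :
    (Sum.inr v : Vert n k E t) ∉ auxD E s t := by
  rintro ⟨w, hw, e⟩
  exact nomatch e

theorem aux_tri {n k : ℕ} {E : Fin n × Fin k → Fin n × Fin k → Prop}
    (hE : MatchedLayered E) {s t : Fin n × Fin k} (hs : (s.2 : ℕ) = 0)
    (hreach : Relation.ReflTransGen E s t) {x y : Vert n k E t}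
    (h : GRel E s t x y) (hx : x ∉ auxD E s t) (hy : y ∉ auxD E s t) :
    ∃ z, z ∉ auxD E s t ∧ (GRel E s t x z ∨ GRel E s t z x) ∧
      (GRel E s t y z ∨ GRel E s t z y) := by
  cases h with
  | base h =>
    exact ⟨_, aux_inr, .inl (.triBaseFst ⟨(_, _), h⟩ 0), .inl (.triBaseSnd ⟨(_, _), h⟩ 0)⟩
  | plus a => exact ⟨_, aux_inr, .inl (.triPlusFst a 0), .inl (.triPlusSnd a 0)⟩
  | pendant j => exact absurd (aux_inl.2 .refl) hx
  | triBaseFst p j =>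
    exact ⟨_, fun h => hx (aux_inl.2 (aux_back hE hs (aux_inl.1 h) p.2)),
      .inl (.base p.2), .inr (.triBaseSnd p j)⟩
  | triBaseSnd p j =>
    exact ⟨_, fun h => hx (aux_inl.2 ((aux_inl.1 h).tail p.2)),
      .inr (.base p.2), .inr (.triBaseFst p j)⟩
  | triPlusFst a j =>
    exact ⟨_, aux_inr, .inl (.plus a), .inr (.triPlusSnd a j)⟩
  | triPlusSnd a j =>
    refine ⟨_, fun h => a.2 ?_, .inr (.plus a), .inr (.triPlusFst a j)⟩
    exact congrArg Prod.fst (aux_inj hE hs (aux_inl.1 h) t hreach rfl)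

/-- if `t` is reachable from `s` in the matched layered graph `G`, then
at most `k` vertices can be deleted from `G′` so that the remaining induced subgraph
satisfies property `Q`. -/
theorem stmt_8 {n k : ℕ} (E : Fin n × Fin k → Fin n × Fin k → Prop)
    (hE : MatchedLayered E) (s t : Fin n × Fin k)
    (hs : (s.2 : ℕ) = 0) (ht : (t.2 : ℕ) + 1 = k)
    (hreach : Relation.ReflTransGen E s t) :
    ∃ D : Set (Vert n k E t), D.ncard ≤ k ∧
      PropQ ((SimpleGraph.fromRel (GRel E s t)).induce Dᶜ) := by
  have key : ∀ x z : Vert n k E t, (GRel E s t x z ∨ GRel E s t z x) →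
      (SimpleGraph.fromRel (GRel E s t)).Adj x z := by
    intro x z h
    rw [SimpleGraph.fromRel_adj]
    exact ⟨h.elim (aux_irrefl hE) (fun h => (aux_irrefl hE h).symm), h⟩
  refine ⟨auxD E s t, ?_, ?_⟩
  · have h1 : (auxD E s t).ncard ≤ {v | Relation.ReflTransGen E s v}.ncard :=
      Set.ncard_image_le (Set.toFinite _)
    have h2 : {v | Relation.ReflTransGen E s v}.ncard ≤ (Set.univ : Set (Fin k)).ncard :=
      Set.ncard_le_ncard_of_injOn Prod.snd (fun _ _ => Set.mem_univ _)
        (fun v hv w hw h => aux_inj hE hs hv w hw h) (Set.toFinite _)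
    rw [Set.ncard_univ, Nat.card_fin] at h2
    exact h1.trans h2
  · rintro ⟨x, hx⟩ ⟨y, hy⟩ h
    have h' : (SimpleGraph.fromRel (GRel E s t)).Adj x y := h
    rw [SimpleGraph.fromRel_adj] at h'
    rcases h'.2 with h | h
    · obtain ⟨z, hz, h1, h2⟩ := aux_tri hE hs hreach h hx hy
      exact ⟨⟨z, hz⟩, key _ _ h1, key _ _ h2⟩
    · obtain ⟨z, hz, h1, h2⟩ := aux_tri hE hs hreach h hy hx
      exact ⟨⟨z, hz⟩, key _ _ h2, key _ _ h1⟩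
end

section
/- If there is a set D of at most k vertices of G′ such that the induced subgraph G′ ∖ D satisfies property Q, then t is reachable from s by a directed path in G. -/
instance vertFinite (n k : ℕ) (E : Fin n × Fin k → Fin n × Fin k → Prop) (t : Fin n × Fin k) :
    Finite (Vert n k E t) := by
  unfold Vert; infer_instance

theorem exists_notin {n k : ℕ} {E : Fin n × Fin k → Fin n × Fin k → Prop} {t : Fin n × Fin k}
    (D : Set (Vert n k E t)) (hD : D.ncard ≤ k) (f : Fin (k + 1) → Vert n k E t)
    (hf : Function.Injective f) : ∃ j, f j ∉ D := by
  by_contra! h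
  have h1 : (Set.range f).ncard ≤ D.ncard :=
    Set.ncard_le_ncard (by rintro _ ⟨j, rfl⟩; exact h j) (Set.toFinite D)
  rw [Set.ncard_range_of_injective hf] at h1
  simp at h1
  omega

theorem tri {n k : ℕ} {E : Fin n × Fin k → Fin n × Fin k → Prop} {s t : Fin n × Fin k}
    {D : Set (Vert n k E t)} (hQ : PropQ ((SimpleGraph.fromRel (GRel E s t)).induce Dᶜ))
    {x y : Vert n k E t} (hx : x ∉ D) (hy : y ∉ D) (hne : x ≠ y) (h : GRel E s t x y) :
    ∃ z, z ∉ D ∧ z ≠ x ∧ z ≠ y ∧ (GRel E s t y z ∨ GRel E s t z y) := by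
  obtain ⟨⟨z, hz⟩, h1, h2⟩ := hQ ⟨x, hx⟩ ⟨y, hy⟩
    (by simp [SimpleGraph.fromRel_adj, hne, h])
  simp only [SimpleGraph.comap_adj, SimpleGraph.induce, SimpleGraph.fromRel_adj,
    Function.Embedding.subtype_apply] at h1 h2
  exact ⟨z, hz, h1.1.symm, h2.1.symm, h2.2⟩

/-- if at most `k` vertices can be deleted from `G′` so that the
remaining induced subgraph satisfies property `Q`, then `t` is reachable from `s`
in the matched layered graph `G`. -/
theorem stmt_9 {n k : ℕ} (E : Fin n × Fin k → Fin n × Fin k → Prop)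
    (hE : MatchedLayered E) (s t : Fin n × Fin k)
    (hs : (s.2 : ℕ) = 0) (ht : (t.2 : ℕ) + 1 = k)
    (hdel : ∃ D : Set (Vert n k E t), D.ncard ≤ k ∧
      PropQ ((SimpleGraph.fromRel (GRel E s t)).induce Dᶜ)) :
    Relation.ReflTransGen E s t := by
  obtain ⟨D, hD, hQ⟩ := hdel
  have hsD : (Sum.inl s : Vert n k E t) ∈ D := by
    by_contra hsD
    obtain ⟨j, hj⟩ := exists_notin D hD (fun j => Sum.inr (Sum.inr (Sum.inl j)))
      (fun a b h => by injections)
    obtain ⟨z, hz, hzx, hzy, h | h⟩ := tri hQ hsD hj Sum.inl_ne_inr (GRel.pendant j)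
    · cases h
    · cases h
      exact hzx rfl
  have step : ∀ v w, E v w → (Sum.inl v : Vert n k E t) ∈ D →
      (Sum.inl w : Vert n k E t) ∈ D := by
    intro v w hvw hv
    by_contra hw
    obtain ⟨j, hj⟩ := exists_notin D hD
      (fun j => Sum.inr (Sum.inr (Sum.inr (Sum.inl (⟨(v, w), hvw⟩, j)))))
      (fun a b h => by injections; simp_all)
    obtain ⟨z, hz, hzx, hzy, h | h⟩ := tri hQ hw hj Sum.inl_ne_inr
      (GRel.triBaseSnd ⟨(v, w), hvw⟩ j)
    · cases h
    · cases h
      · exact hz hv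
      · exact hzx rfl
  have plus : ∀ a : {a : Fin n // a ≠ t.1}, (Sum.inl (a.1, t.2) : Vert n k E t) ∈ D →
      (Sum.inr (Sum.inl a) : Vert n k E t) ∈ D := by
    intro a hv
    by_contra hw
    obtain ⟨j, hj⟩ := exists_notin D hD
      (fun j => Sum.inr (Sum.inr (Sum.inr (Sum.inr (a, j)))))
      (fun a b h => by injections; simp_all)
    obtain ⟨z, hz, hzx, hzy, h | h⟩ := tri hQ hw hj
      (fun h => by have := Sum.inr_injective h; cases this)
      (GRel.triPlusSnd a j)
    · cases h
    · cases h
      · exact hz hv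
      · exact hzx rfl
  have path : ∀ i : ℕ, i < k → ∃ v : Fin n × Fin k, (v.2 : ℕ) = i ∧
      Relation.ReflTransGen E s v ∧ (Sum.inl v : Vert n k E t) ∈ D := by
    intro i
    induction i with
    | zero => exact fun _ => ⟨s, hs, .refl, hsD⟩
    | succ i ih =>
      intro hi
      obtain ⟨v, hv, hr, hvD⟩ := ih (by omega)
      obtain ⟨w, hw, -⟩ := hE.2.1 v (by omega)
      exact ⟨w, by rw [hE.1 v w hw, hv], hr.tail hw, step v w hw hvD⟩
  by_contra hnot
  choose f hf1 hf2 hf3 using fun i : Fin k => path i i.2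
  have hlast : (f t.2).2 = t.2 := Fin.ext (hf1 t.2)
  have hne : (f t.2).1 ≠ t.1 := by
    intro h
    have h2 : f t.2 = t := Prod.ext h hlast
    exact hnot (h2 ▸ hf2 t.2)
  have hp := plus ⟨(f t.2).1, hne⟩ (by
    have h2 : ((f t.2).1, t.2) = f t.2 := Prod.ext rfl hlast.symm
    simp only [h2]
    exact hf3 t.2)
  obtain ⟨j, hj⟩ := exists_notin D hD
    (Fin.cons (Sum.inr (Sum.inl ⟨(f t.2).1, hne⟩)) (fun i => Sum.inl (f i)))
    (by
      refine Fin.cons_injective_iff.2 ⟨?_, ?_⟩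
      · rintro ⟨i, hi⟩
        exact Sum.inl_ne_inr hi
      · intro a b h
        have h' := Sum.inl_injective h
        apply Fin.ext
        rw [← hf1 a, ← hf1 b, h'])
  refine hj ?_
  cases j using Fin.cases with
  | zero => exact hp
  | succ i => exact hf3 i
end
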